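/- arXiv:2605.00949 — 2 statements merged into one kernel-verified Lean document; each statement's English description precedes it below -/
import Mathlib

section
/- Let 𝓕(x) = (x^k + b)^n + c·∑_{i=1}^{n} a^{i-1} (x^k + b)^{n-i} ∈ ℤ[x] be irreducible of degree nk over ℚ, let θ be a root of 𝓕, and K = ℚ(θ). Let p be a prime divisor of the discriminant 𝔇_𝓕 with p ∤ cka and p ∣ n. Then p does not divide the index [ℤ_K : ℤ[θ]] if and only if (k ≥ 2 implies p² ∤ f_2(b)). -/
open Polynomial

/-- `D` is the discriminant of the integer polynomial `f`: writing the roots of `f`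
in `ℂ` as `θ_1, …, θ_d` (so that `f` splits as `∏ (X - θ_i)` over `ℂ`),
`D = ∏_{i < j} (θ_i - θ_j)^2`. -/
def IsDiscriminant (f : Polynomial ℤ) (D : ℤ) : Prop :=
  ∃ θ : Fin f.natDegree → ℂ,
    f.map (algebraMap ℤ ℂ) = ∏ i, (X - C (θ i)) ∧
      (D : ℂ) = ∏ i, ∏ j ∈ Finset.Ioi i, (θ i - θ j) ^ 2

/-- A prime dividing a nonzero index of an additive subgroup yields an element outside the subgroup
whose multiple by the prime lies inside. -/
theorem AddSubgroup.exists_notMem_nsmul_mem_of_dvd_index {G : Type*} [AddCommGroup G]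
    (H : AddSubgroup G) [H.FiniteIndex] {p : ℕ} (hp : p.Prime) (h : p ∣ H.index) :
    ∃ x ∉ H, p • x ∈ H := by
  have := Fact.mk hp
  obtain ⟨y, hy⟩ := exists_prime_addOrderOf_dvd_card' (G := G ⧸ H) p h
  obtain ⟨x, rfl⟩ := QuotientAddGroup.mk_surjective y
  refine ⟨x, fun hx => ?_, ?_⟩
  · rw [(QuotientAddGroup.eq_zero_iff x).2 hx, addOrderOf_zero] at hy
    exact hp.one_lt.ne hy
  · have := addOrderOf_nsmul_eq_zero (x : G ⧸ H)
    rw [hy] at this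
    exact (QuotientAddGroup.eq_zero_iff _).1 this

/-- An element outside an additive subgroup whose multiple by a prime lies inside forces the prime
to divide the index. -/
theorem AddSubgroup.dvd_index_of_notMem_of_nsmul_mem {G : Type*} [AddCommGroup G]
    (H : AddSubgroup G) {p : ℕ} (hp : p.Prime) {x : G} (hx : x ∉ H) (hpx : p • x ∈ H) :
    p ∣ H.index := by
  have := Fact.mk hp
  have h : addOrderOf (x : G ⧸ H) = p :=
    addOrderOf_eq_prime ((QuotientAddGroup.eq_zero_iff _).2 hpx)
      fun h => hx ((QuotientAddGroup.eq_zero_iff _).1 h)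
  exact h ▸ _root_.addOrderOf_dvd_natCard (x : G ⧸ H)

theorem Polynomial.Monic.eq_minpoly_int {S : Type*} [CommRing S] [IsDomain S]
    [Module.IsTorsionFree ℤ S] {s : S} {f : ℤ[X]} (hf : f.Monic) (hirr : Irreducible f)
    (hs : aeval s f = 0) : f = minpoly ℤ s := by
  have hint : IsIntegral ℤ s := ⟨f, hf, hs⟩
  exact (eq_of_monic_of_associated (minpoly.monic hint) hf
    ((minpoly.irreducible hint).associated_of_dvd hirr
      (minpoly.isIntegrallyClosed_dvd hint hs))).symm

section Order

variable {K : Type*} [Field K] [NumberField K]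

theorem aeval_derivative_minpoly_mul_mem_adjoin (θ : NumberField.RingOfIntegers K)
    (hgen : Algebra.adjoin ℚ {(θ : K)} = ⊤) (α : NumberField.RingOfIntegers K) :
    aeval θ (derivative (minpoly ℤ θ)) * α ∈ Algebra.adjoin ℤ {θ} := by
  have h : aeval θ (derivative (minpoly ℤ θ)) ∈ conductor ℤ θ := by
    have hle : conductor ℤ θ * differentIdeal ℤ (NumberField.RingOfIntegers K) ≤ conductor ℤ θ := Ideal.mul_le_left
    rw [conductor_mul_differentIdeal ℤ ℚ K θ hgen] at hle
    exact hle (Ideal.mem_span_singleton_self _)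
  exact mem_conductor_iff.1 h α

theorem adjoin_int_finiteIndex (θ : NumberField.RingOfIntegers K) (hgen : Algebra.adjoin ℚ {(θ : K)} = ⊤) :
    (Algebra.adjoin ℤ {θ}).toSubring.toAddSubgroup.FiniteIndex := by
  set d := aeval θ (derivative (minpoly ℤ θ)) with hd
  have hint : IsIntegral ℤ θ := NumberField.RingOfIntegers.isIntegral θ
  have hd0 : d ≠ 0 := by
    have h : aeval (θ : K) (derivative (minpoly ℚ (θ : K))) ≠ 0 :=
      (Algebra.IsSeparable.isSeparable ℚ (θ : K)).aeval_derivative_ne_zero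
        (minpoly.aeval ℚ (θ : K))
    rw [minpoly.isIntegrallyClosed_eq_field_fractions ℚ K hint, derivative_map,
      aeval_map_algebraMap, aeval_algebraMap_apply] at h
    exact fun h0 => h (by rw [← hd, h0, map_zero])
  have hfin : (Submodule.toAddSubgroup (Ideal.span {d})).FiniteIndex :=
    Ideal.finiteIndex (by simpa using hd0)
  refine AddSubgroup.finiteIndex_of_le (H := Submodule.toAddSubgroup (Ideal.span {d})) ?_
  intro x hx
  obtain ⟨y, rfl⟩ := Ideal.mem_span_singleton'.1 hx
  rw [mul_comm]
  exact aeval_derivative_minpoly_mul_mem_adjoin θ hgen y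

end Order

section Subalgebra

variable {S : Type*} [CommRing S] {A : Subalgebra ℤ S}

theorem Subalgebra.mem_of_isCoprime_mul_mem {r s : ℤ} (h : IsCoprime r s) {α : S}
    (hr : (r : S) * α ∈ A) (hs : (s : S) * α ∈ A) : α ∈ A := by
  obtain ⟨u, v, huv⟩ := h
  have : α = u * (r * α) + v * (s * α) := by
    have h1 : (u * r + v * s : S) = 1 := by
      simpa using congrArg (Int.cast : ℤ → S) huv
    linear_combination (-α) * h1
  rw [this]
  exact add_mem (mul_mem (intCast_mem A u) hr) (mul_mem (intCast_mem A v) hs)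

end Subalgebra

/-- If `θ` is a root of `X ^ k * h + p * u` with `p ∤ u` and `1 ≤ k`, then an integral
element `β` with `p * β` and `θ * β` in `ℤ[θ]` already lies in `ℤ[θ]`. -/
theorem mem_adjoin_of_mul_mem_of_not_sq_dvd {S : Type*} [CommRing S] [IsDomain S] {θ : S}
    {f h : ℤ[X]} {m : ℕ} {p u : ℤ} (hp : Prime p) (hf : f = X ^ (m + 1) * h + C (p * u))
    (hdvd : ∀ g : ℤ[X], aeval θ g = 0 → f ∣ g) (hroot : aeval θ f = 0) (hθ : θ ≠ 0)
    (hu : ¬ p ∣ u) {β : S} (hβ : IsIntegral ℤ β) (hpβ : (p : S) * β ∈ Algebra.adjoin ℤ {θ})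
    (hθβ : θ * β ∈ Algebra.adjoin ℤ {θ}) : β ∈ Algebra.adjoin ℤ {θ} := by
  have hmem (g : ℤ[X]) : aeval θ g ∈ Algebra.adjoin ℤ {θ} := aeval_mem_adjoin_singleton ℤ θ
  obtain ⟨G, hG⟩ : ∃ G : ℤ[X], aeval θ G = θ * β := by
    rwa [Algebra.adjoin_singleton_eq_range_aeval] at hθβ
  have hcop : IsCoprime p u := (hp.coprime_iff_not_dvd).2 hu
  -- `G ^ d` is a multiple of `X` modulo `f`
  obtain ⟨P, hPmonic, hP⟩ := hβ
  rw [← aeval_def] at hP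
  have hpow : ∃ Q : ℤ[X], aeval θ (G ^ P.natDegree + X * Q) = 0 := by
    refine ⟨∑ i ∈ Finset.range P.natDegree,
      C (P.coeff i) * G ^ i * X ^ (P.natDegree - 1 - i), ?_⟩
    rw [hPmonic.as_sum] at hP
    have key := congrArg (θ ^ P.natDegree * ·) hP
    simp only [map_add, map_mul, map_pow, map_sum, aeval_X, aeval_C, hG] at key ⊢
    rw [mul_add, Finset.mul_sum, mul_zero] at key
    refine Eq.trans ?_ key
    rw [mul_pow, add_right_inj, Finset.mul_sum]
    refine Finset.sum_congr rfl fun i hi => ?_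
    obtain ⟨j, hj⟩ := Nat.exists_eq_add_of_lt (Finset.mem_range.1 hi)
    rw [hj, show i + j + 1 - 1 - i = j by omega]
    ring
  obtain ⟨Q, hQ⟩ := hpow
  obtain ⟨R, hR⟩ := hdvd _ hQ
  have hG0 : p ∣ G.eval 0 := by
    have := congrArg (eval 0) hR
    simp [hf] at this
    exact hp.dvd_of_dvd_pow ⟨u * R.eval 0, by rw [this, mul_assoc]⟩
  obtain ⟨e, he⟩ := hG0
  obtain ⟨δ, hδ⟩ : X ∣ G - C (G.eval 0) := by
    simpa using X_sub_C_dvd_sub_C_eval (a := 0) (p := G)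
  have hGθ : θ * β = θ * aeval θ δ + p * e := by
    have := congrArg (aeval θ) hδ
    simp [hG, he] at this
    linear_combination this
  have hfθ : θ ^ (m + 1) * aeval θ h + p * u = 0 := by
    simpa [hf] using hroot
  refine Subalgebra.mem_of_isCoprime_mul_mem hcop hpβ ?_
  have : (u : S) * β = aeval θ (C u * δ - X ^ m * h * C e) := by
    apply mul_left_cancel₀ hθ
    simp only [map_sub, map_mul, map_pow, aeval_X, aeval_C]
    simp only [algebraMap_int_eq, eq_intCast]
    linear_combination (u : S) * hGθ + e * hfθ
  rw [this]
  exact hmem _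

/-- If `p ^ 2` divides `f(0)` where `f = X ^ k * h + f(0)` is the monic minimal polynomial of `θ`
and `2 ≤ k`, then some integral element `β ∉ ℤ[θ]` satisfies `p * β ∈ ℤ[θ]`. -/
theorem exists_notMem_adjoin_of_sq_dvd {K : Type*} [Field K] [NumberField K]
    {θ : NumberField.RingOfIntegers K} {f h : ℤ[X]} {m : ℕ} {p : ℕ} {v : ℤ} (hp : p.Prime)
    (hf : f = X ^ (m + 2) * h + C ((p : ℤ) ^ 2 * v)) (hmonic : f.Monic)
    (hdvd : ∀ g : ℤ[X], aeval θ g = 0 → f ∣ g) (hroot : aeval θ f = 0)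
    (hdeg : 0 < f.natDegree) :
    ∃ β : NumberField.RingOfIntegers K, β ∉ Algebra.adjoin ℤ {θ} ∧
      p • β ∈ Algebra.adjoin ℤ {θ} := by
  have := Fact.mk hp
  have hp0 : (p : K) ≠ 0 := Nat.cast_ne_zero.2 hp.ne_zero
  set g : ℤ[X] := X ^ (m + 1) * h with hg
  have hfg : X * g = f - C ((p : ℤ) ^ 2 * v) := by rw [hf, hg]; ring
  have hXg : (X * g).Monic := by
    rw [hfg]
    exact hmonic.sub_of_left (lt_of_le_of_lt degree_C_le (natDegree_pos_iff_degree_pos.1 hdeg))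
  have hgm : g.Monic := monic_X.of_mul_monic_left hXg
  have hgdeg : g.natDegree < f.natDegree := by
    have : (X * g).natDegree = f.natDegree := by rw [hfg, natDegree_sub_C]
    rw [monic_X.natDegree_mul hgm, natDegree_X] at this
    omega
  have hfθ : θ ^ (m + 2) * aeval θ h + p ^ 2 * v = 0 := by
    simpa [hf] using hroot
  have hint : IsIntegral ℤ ((aeval θ g : NumberField.RingOfIntegers K) / p : K) := by
    have hsq : ((aeval θ g : NumberField.RingOfIntegers K) / p : K) ^ 2 =
        ((-v * θ ^ m * aeval θ h : NumberField.RingOfIntegers K) : K) := by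
      rw [div_pow, div_eq_iff (pow_ne_zero 2 hp0)]
      have : (aeval θ g) ^ 2 = (-v * θ ^ m * aeval θ h) * (p : NumberField.RingOfIntegers K) ^ 2 := by
        simp only [hg, map_mul, map_pow, aeval_X]
        linear_combination (θ ^ m * aeval θ h) * hfθ
      have := congrArg (algebraMap (NumberField.RingOfIntegers K) K) this
      simpa only [map_mul, map_pow, map_natCast] using this
    refine IsIntegral.of_pow (n := 2) two_pos ?_
    rw [hsq]
    exact NumberField.RingOfIntegers.isIntegral_coe _
  obtain ⟨β, hβ⟩ : ∃ β : NumberField.RingOfIntegers K, (p : NumberField.RingOfIntegers K) * β =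
      aeval θ g := by
    refine ⟨⟨_, hint⟩, NumberField.RingOfIntegers.ext ?_⟩
    exact (map_mul (algebraMap (NumberField.RingOfIntegers K) K) _ _).trans
      (by rw [map_natCast]; exact mul_div_cancel₀ _ hp0)
  refine ⟨β, fun hmem => ?_, ?_⟩
  · rw [Algebra.adjoin_singleton_eq_range_aeval] at hmem
    obtain ⟨R, hR⟩ := hmem
    have h0 : aeval θ (g - C (p : ℤ) * R) = 0 := by
      replace hR : aeval θ R = β := hR
      rw [map_sub, map_mul (aeval θ) (C (p : ℤ)), hR, ← hβ]
      simp
    have := (map_dvd (mapRingHom (Int.castRingHom (ZMod p))) (hdvd _ h0))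
    simp only [coe_mapRingHom, Polynomial.map_sub, Polynomial.map_mul, Polynomial.map_C] at this
    simp only [eq_intCast, Int.cast_natCast, CharP.cast_eq_zero, map_zero, zero_mul,
      sub_zero] at this
    refine (hmonic.map (Int.castRingHom (ZMod p))).not_dvd_of_natDegree_lt
      (hgm.map _).ne_zero ?_ this
    rwa [hmonic.natDegree_map, hgm.natDegree_map]
  · rw [nsmul_eq_mul, hβ]
    exact aeval_mem_adjoin_singleton ℤ θ

/-- The polynomial `X ^ n + c * ∑ i ∈ [1, n], a ^ (i - 1) * X ^ (n - i)`. -/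
noncomputable def geomTrinomial (n : ℕ) (a c : ℤ) : ℤ[X] :=
  X ^ n + C c * ∑ i ∈ Finset.Icc 1 n, C a ^ (i - 1) * X ^ (n - i)

theorem X_sub_C_mul_geomTrinomial (n : ℕ) (a c : ℤ) :
    (X - C a) * geomTrinomial n a c = X ^ n * (X - C a + C c) - C (c * a ^ n) := by
  have h : ∑ i ∈ Finset.Icc 1 n, (C a : ℤ[X]) ^ (i - 1) * X ^ (n - i) =
      ∑ i ∈ Finset.range n, C a ^ i * X ^ (n - 1 - i) := by
    rw [Finset.range_eq_Ico, ← Finset.Ico_add_one_right_eq_Icc,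
      Finset.sum_Ico_eq_sum_range, ← Finset.range_eq_Ico]
    refine Finset.sum_congr (by simp) fun i _ => ?_
    rw [Nat.add_sub_cancel_left, Nat.sub_sub]
  have h2 := geom_sum₂_mul (C a : ℤ[X]) X n
  rw [geomTrinomial, h]
  rw [C_mul, C_pow]
  linear_combination (-C c) * h2

theorem monic_geomTrinomial {n : ℕ} (a c : ℤ) : (geomTrinomial n a c).Monic := by
  refine (monic_X_sub_C a).of_mul_monic_left ?_
  rw [X_sub_C_mul_geomTrinomial]
  have h : (X ^ n * (X - C a + C c) : ℤ[X]).Monic := by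
    rw [show (X : ℤ[X]) - C a + C c = X - C (a - c) by rw [C_sub]; ring]
    exact (monic_X_pow n).mul (monic_X_sub_C _)
  refine h.sub_of_left (lt_of_le_of_lt degree_C_le ?_)
  rw [show (X : ℤ[X]) - C a + C c = X - C (a - c) by rw [C_sub]; ring, degree_mul, degree_X_pow,
    degree_X_sub_C]
  exact_mod_cast Nat.succ_pos n

/-- At a root `y` of the polynomial, its derivative satisfies a congruence modulo `n`. -/
theorem aeval_derivative_geomTrinomial {S : Type*} [CommRing S] {n : ℕ} {a c : ℤ}
    {y : S} (hy : aeval y (geomTrinomial n a c) = 0) :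
    (y - a + c) * (y - a) * aeval y (derivative (geomTrinomial n a c)) =
      c * a ^ n + n * y ^ (n - 1) * (y - a + c) ^ 2 := by
  have h1 := congrArg (aeval y) (X_sub_C_mul_geomTrinomial n a c)
  have h2 := congrArg (fun q => aeval y (derivative q)) (X_sub_C_mul_geomTrinomial n a c)
  simp only [derivative_mul, derivative_X_pow, derivative_sub, derivative_add, derivative_X,
    derivative_C, aeval_mul, aeval_sub, aeval_add, map_pow (aeval (R := ℤ) y),
    aeval_X, aeval_C, hy, aeval_one, aeval_zero] at h1 h2
  simp only [algebraMap_int_eq, eq_intCast, map_natCast, Int.cast_mul, Int.cast_pow] at h1 h2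
  linear_combination (y - a + c) * h2 - h1

theorem stmt_12
    (n k : ℕ) (hn : 3 ≤ n) (hk : 1 ≤ k) (a b c : ℤ)
    (F : Polynomial ℤ)
    (hF : F = (X ^ k + C b) ^ n +
        C c * ∑ i ∈ Finset.Icc 1 n, C a ^ (i - 1) * (X ^ k + C b) ^ (n - i))
    (hFdeg : F.natDegree = n * k)
    (hFirr : Irreducible (F.map (algebraMap ℤ ℚ)))
    (K : Type*) [Field K] [NumberField K]
    (θ : NumberField.RingOfIntegers K)
    (hθ : aeval θ F = 0)
    (hgen : Algebra.adjoin ℚ {(θ : K)} = ⊤)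
    (D : ℤ) (hD : IsDiscriminant F D)
    (p : ℕ) (hp : p.Prime) (hpD : (p : ℤ) ∣ D)
    (hpcka : ¬ (p : ℤ) ∣ c * (k : ℤ) * a) (hpn : p ∣ n) :
    (¬ p ∣ (Algebra.adjoin ℤ {θ}).toSubring.toAddSubgroup.index) ↔
      (2 ≤ k → ¬ (p : ℤ) ^ 2 ∣ (b ^ n + c * ∑ i ∈ Finset.Icc 1 n, a ^ (i - 1) * b ^ (n - i))) := by
  have hFcomp : F = (geomTrinomial n a c).comp (X ^ k + C b) := by
    rw [hF]
    simp [geomTrinomial, sum_comp]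
  have hdegY : (X ^ k + C b : ℤ[X]).natDegree = k := natDegree_X_pow_add_C
  have hFmonic : F.Monic := by
    rw [hFcomp]
    refine (monic_geomTrinomial a c).comp (monic_X_pow_add_C b (by omega)) (by omega)
  have hFmin : F = minpoly ℤ θ :=
    hFmonic.eq_minpoly_int (hFmonic.irreducible_of_irreducible_map (algebraMap ℤ ℚ) F hFirr) hθ
  have hdvd (g : ℤ[X]) (hg : aeval θ g = 0) : F ∣ g := by
    rw [hFmin]
    exact minpoly.isIntegrallyClosed_dvd (NumberField.RingOfIntegers.isIntegral θ) hg
  have hpZ : Prime (p : ℤ) := Nat.prime_iff_prime_int.1 hp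
  set f₀ : ℤ := b ^ n + c * ∑ i ∈ Finset.Icc 1 n, a ^ (i - 1) * b ^ (n - i) with hf₀
  obtain ⟨h, hh⟩ : ∃ h : ℤ[X], F = X ^ k * h + C f₀ := by
    have heval : (geomTrinomial n a c).eval b = f₀ := by
      simp [geomTrinomial, hf₀, eval_finsetSum]
    obtain ⟨q, hq⟩ := X_sub_C_dvd_sub_C_eval (a := b) (p := geomTrinomial n a c)
    refine ⟨q.comp (X ^ k + C b), ?_⟩
    have := congrArg (fun g : ℤ[X] => g.comp (X ^ k + C b)) hq
    simp only [sub_comp, C_comp, mul_comp, X_comp, heval, ← hFcomp] at this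
    linear_combination this
  constructor
  · intro hind hk2 hsq
    obtain ⟨m, rfl⟩ := Nat.exists_eq_add_of_le' hk2
    obtain ⟨v, hv⟩ := hsq
    rw [hv] at hh
    obtain ⟨β, hβ, hpβ⟩ := exists_notMem_adjoin_of_sq_dvd hp hh hFmonic hdvd hθ
      (hFdeg ▸ Nat.mul_pos (by omega) hk)
    exact hind (AddSubgroup.dvd_index_of_notMem_of_nsmul_mem _ hp hβ hpβ)
  · intro hcond hind
    have := adjoin_int_finiteIndex θ hgen
    obtain ⟨α, hα, hpα⟩ := AddSubgroup.exists_notMem_nsmul_mem_of_dvd_index _ hp hind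
    replace hα : α ∉ Algebra.adjoin ℤ {θ} := hα
    replace hpα : ((p : ℤ) : NumberField.RingOfIntegers K) * α ∈ Algebra.adjoin ℤ {θ} := by
      rw [nsmul_eq_mul] at hpα
      simpa using hpα
    apply hα
    have hmem (g : ℤ[X]) : aeval θ g ∈ Algebra.adjoin ℤ {θ} := aeval_mem_adjoin_singleton ℤ θ
    have hder := aeval_derivative_minpoly_mul_mem_adjoin θ hgen α
    obtain ⟨m, rfl⟩ := Nat.exists_eq_add_of_le' hk
    -- the derivative of `F` at `θ` is, up to units, `θ ^ (k - 1)` modulo `p`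
    have hstep : θ ^ m * α ∈ Algebra.adjoin ℤ {θ} := by
      obtain ⟨r, rfl⟩ := hpn
      have hy : aeval (θ ^ (m + 1) + (b : NumberField.RingOfIntegers K))
          (geomTrinomial (p * r) a c) = 0 := by
        rw [hFcomp, aeval_comp] at hθ
        simpa using hθ
      have hkey := aeval_derivative_geomTrinomial hy
      rw [← hFmin, hFcomp, derivative_comp] at hder
      simp [aeval_comp] at hder
      have hcop : IsCoprime (p : ℤ) (c * a ^ (p * r) * (m + 1 : ℕ)) := by
        refine hpZ.coprime_iff_not_dvd.2 fun hd => hpcka ?_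
        rcases hpZ.dvd_or_dvd hd with hd | hd
        · rcases hpZ.dvd_or_dvd hd with hd | hd
          · exact (hd.mul_right _).mul_right _
          · exact (hpZ.dvd_of_dvd_pow hd).mul_left _
        · exact (hd.mul_left _).mul_right _
      refine Subalgebra.mem_of_isCoprime_mul_mem hcop ?_ ?_
      · rw [mul_left_comm]
        simpa using mul_mem (hmem (X ^ m)) hpα
      · set y := θ ^ (m + 1) + (b : NumberField.RingOfIntegers K) with hydef
        have hyA : y ∈ Algebra.adjoin ℤ {θ} := by
          rw [show y = aeval θ (X ^ (m + 1) + C b) by simp [hydef]]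
          exact hmem _
        have hθA : θ ∈ Algebra.adjoin ℤ {θ} := Algebra.self_mem_adjoin_singleton ℤ θ
        have haA := intCast_mem (Algebra.adjoin ℤ {θ}) a
        have hcA := intCast_mem (Algebra.adjoin ℤ {θ}) c
        have hyc := add_mem (sub_mem hyA haA) hcA
        have h1 := mul_mem (mul_mem hyc (sub_mem hyA haA)) hder
        have h2 := mul_mem (mul_mem (mul_mem (mul_mem
          (natCast_mem (Algebra.adjoin ℤ {θ}) (r * (m + 1))) (pow_mem hyA (p * r - 1)))
          (pow_mem hyc 2)) (pow_mem hθA m)) hpα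
        convert sub_mem h1 h2 using 1
        push_cast at hkey ⊢
        linear_combination (-(m + 1) * θ ^ m * α) * hkey
    have hfθ : θ ^ (m + 1) * aeval θ h + f₀ = 0 := by
      simpa [hh] using hθ
    by_cases hpf : (p : ℤ) ∣ f₀
    · rcases Nat.eq_zero_or_pos m with rfl | hm
      · simpa using hstep
      obtain ⟨u, hu⟩ := hpf
      have hsq := hcond (by omega)
      have hpu : ¬ (p : ℤ) ∣ u := by
        rintro ⟨w, rfl⟩
        exact hsq ⟨w, by rw [hu]; ring⟩
      have hθ0 : θ ≠ 0 := by
        rintro rfl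
        refine hsq ?_
        have : f₀ = 0 := by simpa using hfθ
        rw [this]
        exact dvd_zero _
      rw [hu] at hh
      have hdesc : ∀ j : ℕ, θ ^ j * α ∈ Algebra.adjoin ℤ {θ} → α ∈ Algebra.adjoin ℤ {θ} := by
        intro j
        induction j with
        | zero => simp
        | succ j ih =>
          intro hj
          refine ih (mem_adjoin_of_mul_mem_of_not_sq_dvd hpZ hh hdvd hθ hθ0 hpu
            (NumberField.RingOfIntegers.isIntegral _) ?_ ?_)
          · rw [mul_left_comm]
            simpa using mul_mem (hmem (X ^ j)) hpα
          · rwa [← mul_assoc, ← pow_succ']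
      exact hdesc m hstep
    · refine Subalgebra.mem_of_isCoprime_mul_mem (hpZ.coprime_iff_not_dvd.2 hpf) hpα ?_
      have := mul_mem (hmem (-X * h)) hstep
      convert this using 1
      simp
      linear_combination α * hfθ
end

section
/- Let 𝓕(x) = (x^k + b)^n + c·∑_{i=1}^{n} a^{i-1} (x^k + b)^{n-i} ∈ ℤ[x] be irreducible of degree nk over ℚ with n ≥ 3, let θ be a root of 𝓕, and K = ℚ(θ). If p is a prime with p ∣ a and p ∤ c, then 𝓕 is non-monogenic; that is, ℤ_K ≠ ℤ[θ] (equivalently, p divides the index [ℤ_K : ℤ[θ]]). -/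
open Polynomial

/-- The sum `∑ A ^ (i - 1) * Y ^ (n - i)` modulo the square of `A`. -/
lemma exists_sum_Icc_pow_mul_pow_eq {R : Type*} [CommRing R] (A Y : R) (m : ℕ) :
    ∃ T : R, ∑ i ∈ Finset.Icc 1 (m + 3), A ^ (i - 1) * Y ^ (m + 3 - i) =
      Y ^ (m + 2) + A * Y ^ (m + 1) + A ^ 2 * T := by
  refine ⟨∑ j ∈ Finset.range (m + 1), A ^ j * Y ^ (m - j), ?_⟩
  rw [← Finset.Ico_add_one_right_eq_Icc, Finset.sum_Ico_eq_sum_range,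
    show m + 3 + 1 - 1 = (m + 1) + 1 + 1 by omega, Finset.sum_range_succ',
    Finset.sum_range_succ', Finset.mul_sum]
  have h : ∀ j ∈ Finset.range (m + 1),
      A ^ (1 + (j + 1 + 1) - 1) * Y ^ (m + 3 - (1 + (j + 1 + 1))) =
        A ^ 2 * (A ^ j * Y ^ (m - j)) := by
    intro j _
    rw [show 1 + (j + 1 + 1) - 1 = 2 + j by omega,
      show m + 3 - (1 + (j + 1 + 1)) = m - j by omega, pow_add, mul_assoc]
  rw [Finset.sum_congr rfl h]
  simp only [zero_add, add_tsub_cancel_left, pow_one, pow_zero, one_mul,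
    show m + 3 - (1 + 1) = m + 1 by omega, show m + 3 - (1 + 0) = m + 2 by omega]
  ring

/-- In an integrally closed domain, `G / p` belongs to the ring as soon as it is a root of a monic
quadratic polynomial. -/
lemma dvd_of_sq_eq_of_isIntegrallyClosed {R : Type*} [CommRing R] [IsDomain R]
    [IsIntegrallyClosed R] {p G u v : R} (hp : p ≠ 0)
    (h : G ^ 2 + p * u * G + p ^ 2 * v = 0) : p ∣ G := by
  have hp' : algebraMap R (FractionRing R) p ≠ 0 := by
    simpa using hp
  have hint : IsIntegral R (algebraMap R (FractionRing R) G / algebraMap R (FractionRing R) p) := by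
    refine ⟨X ^ 2 + C u * X + C v, by monicity!, ?_⟩
    have h' := congrArg (algebraMap R (FractionRing R)) h
    simp only [map_add, map_mul, map_pow, map_zero] at h'
    simp only [eval₂_add, eval₂_mul, eval₂_pow, eval₂_X, eval₂_C]
    field_simp
    linear_combination h'
  obtain ⟨z, hz⟩ := IsIntegrallyClosed.isIntegral_iff.mp hint
  refine ⟨z, ?_⟩
  apply IsFractionRing.injective R (FractionRing R)
  rw [map_mul, hz]
  field_simp

lemma monic_pow_add_C_mul_sum {R : Type*} [CommRing R] [Nontrivial R] (a c : R) (Y : R[X])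
    (hY : Y.Monic) (hYdeg : 0 < Y.natDegree) {n : ℕ} (hn : 0 < n) :
    (Y ^ n + C c * ∑ i ∈ Finset.Icc 1 n, C a ^ (i - 1) * Y ^ (n - i)).Monic := by
  refine (hY.pow n).add_of_left (degree_lt_degree ?_)
  have hle : (C c * ∑ i ∈ Finset.Icc 1 n, C a ^ (i - 1) * Y ^ (n - i)).natDegree
      ≤ (n - 1) * Y.natDegree := by
    refine (natDegree_C_mul_le _ _).trans (natDegree_sum_le_of_forall_le _ _ fun i hi => ?_)
    rw [← C_pow]
    refine (natDegree_C_mul_le _ _).trans (natDegree_pow_le.trans ?_)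
    have := (Finset.mem_Icc.mp hi).1
    exact Nat.mul_le_mul_right _ (by omega)
  rw [hY.natDegree_pow]
  exact hle.trans_lt (Nat.mul_lt_mul_of_pos_right (by omega) hYdeg)

/-- A monic integer polynomial that is irreducible over `ℚ` divides every integer polynomial
sharing a root with it. -/
lemma dvd_of_aeval_eq_zero_of_irreducible_map {K : Type*} [Field K] [CharZero K] {F P : ℤ[X]}
    (hF : F.Monic) (hirr : Irreducible (F.map (algebraMap ℤ ℚ))) {x : K}
    (hFx : aeval x F = 0) (hPx : aeval x P = 0) : F ∣ P := by
  have hmin : F.map (algebraMap ℤ ℚ) = minpoly ℚ x :=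
    minpoly.eq_of_irreducible_of_monic hirr (by rwa [aeval_map_algebraMap]) (hF.map _)
  have hdvd : F.map (algebraMap ℤ ℚ) ∣ P.map (algebraMap ℤ ℚ) := by
    rw [hmin]
    exact minpoly.dvd ℚ x (by rwa [aeval_map_algebraMap])
  exact (map_dvd_map _ (algebraMap ℤ ℚ).injective_int hF).mp hdvd

theorem stmt_15
    (n k : ℕ) (hn : 3 ≤ n) (hk : 1 ≤ k) (a b c : ℤ)
    (F : Polynomial ℤ)
    (hF : F = (X ^ k + C b) ^ n +
        C c * ∑ i ∈ Finset.Icc 1 n, C a ^ (i - 1) * (X ^ k + C b) ^ (n - i))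
    (hFdeg : F.natDegree = n * k)
    (hFirr : Irreducible (F.map (algebraMap ℤ ℚ)))
    (K : Type*) [Field K] [NumberField K]
    (θ : NumberField.RingOfIntegers K)
    (hθ : aeval θ F = 0)
    (hgen : Algebra.adjoin ℚ {(θ : K)} = ⊤)
    (p : ℕ) (hp : p.Prime) (hpa : (p : ℤ) ∣ a) (hpc : ¬ (p : ℤ) ∣ c) :
    Algebra.adjoin ℤ ({θ} : Set (NumberField.RingOfIntegers K)) ≠ ⊤ := by
  intro htop
  have : Fact p.Prime := ⟨hp⟩
  obtain ⟨m, rfl⟩ : ∃ m, n = m + 3 := ⟨n - 3, by omega⟩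
  obtain ⟨a', rfl⟩ := hpa
  set Y : ℤ[X] := X ^ k + C b with hYdef
  have hYmonic : Y.Monic := monic_X_pow_add_C b (by omega)
  have hYdeg : Y.natDegree = k := natDegree_X_pow_add_C
  have hFmonic : F.Monic := by
    rw [hF]
    exact monic_pow_add_C_mul_sum _ c Y hYmonic (by omega) (by omega)
  obtain ⟨T, hT⟩ := exists_sum_Icc_pow_mul_pow_eq (C ((p : ℤ) * a')) Y m
  rw [hT] at hF
  set G : ℤ[X] := Y ^ (m + 1) * (Y + C c) with hG
  have hdvd : (p : NumberField.RingOfIntegers K) ∣ aeval θ G := by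
    refine dvd_of_sq_eq_of_isIntegrallyClosed (u := aeval θ (C c * C a' * Y ^ m))
      (v := aeval θ (C c * C a' ^ 2 * Y ^ m * (Y + C c) * T))
      (by exact_mod_cast hp.ne_zero) ?_
    have hrel : G ^ 2 + C (p : ℤ) * (C c * C a' * Y ^ m) * G
        + C (p : ℤ) ^ 2 * (C c * C a' ^ 2 * Y ^ m * (Y + C c) * T)
        = Y ^ m * (Y + C c) * F := by
      rw [hF, hG, C_mul]
      ring
    have h := congrArg (aeval θ) hrel
    rw [map_mul _ _ F, hθ, mul_zero] at h
    simpa using h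
  obtain ⟨z, hz⟩ := hdvd
  have hzmem : z ∈ Algebra.adjoin ℤ ({θ} : Set (NumberField.RingOfIntegers K)) := by
    rw [htop]; trivial
  rw [Algebra.adjoin_singleton_eq_range_aeval] at hzmem
  obtain ⟨h, rfl⟩ := hzmem
  have hroot : ∀ P : ℤ[X], aeval θ P = 0 → aeval (θ : K) P = 0 := fun P hP => by
    have := aeval_algebraMap_apply K θ P
    rw [hP, map_zero] at this
    exact this
  have hFdvd : F ∣ G - C (p : ℤ) * h := by
    refine dvd_of_aeval_eq_zero_of_irreducible_map hFmonic hFirr (hroot F hθ) (hroot _ ?_)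
    rw [map_sub, map_mul _ (C _) h, hz]
    simp
  have hmod := Polynomial.map_dvd (Int.castRingHom (ZMod p)) hFdvd
  have hFmod : F.map (Int.castRingHom (ZMod p)) =
      G.map (Int.castRingHom (ZMod p)) * Y.map (Int.castRingHom (ZMod p)) := by
    rw [hF, hG]
    simp only [Polynomial.map_add, Polynomial.map_mul, Polynomial.map_pow, map_C, map_mul,
      map_natCast, Polynomial.map_natCast, CharP.cast_eq_zero]
    ring
  have hGmonic : G.Monic := (hYmonic.pow _).mul
    (hYmonic.add_of_left (degree_C_le.trans_lt (natDegree_pos_iff_degree_pos.mp (by omega))))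
  have hGne : G.map (Int.castRingHom (ZMod p)) ≠ 0 := (hGmonic.map _).ne_zero
  have hdvd' : G.map (Int.castRingHom (ZMod p)) * Y.map (Int.castRingHom (ZMod p)) ∣
      G.map (Int.castRingHom (ZMod p)) * 1 := by
    rw [hFmod] at hmod
    simpa using hmod
  have hunit := isUnit_of_dvd_one ((mul_dvd_mul_iff_left hGne).mp hdvd')
  have hdeg := natDegree_eq_zero_of_isUnit hunit
  rw [hYmonic.natDegree_map] at hdeg
  omega
end
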